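/- Let M₀, M₁ ∈ ℝ^m and S₀, S₁ ∈ ℝ^{m×m} positive definite, let f₀, f₁ be the densities of N(M₀,S₀) and N(M₁,S₁), and define LLR(y) = log f₁(y) − log f₀(y). Set D = M₁ − M₀, Φ₁ = S₁^{1/2}·S₀^{−1}·S₁^{1/2} with orthogonal eigendecomposition Φ₁ = Ψ₁·Λ̄·Ψ₁ᵀ (Λ̄ diagonal with entries λ̄_j), weights w̄_j = (λ̄_j − 1)/2, b₁ = Ψ₁ᵀ·S₁^{1/2}·S₀^{−1}·D, K₁ = {j : w̄_j ≠ 0}, ν̄_j = b_{1,j}/(2w̄_j) for j ∈ K₁, σ₁² = Σ_{j ∉ K₁} b_{1,j}², and C₁ = (log(det S₀/det S₁) + Dᵀ·S₀^{−1}·D)/2 − Σ_{j ∈ K₁} w̄_j·ν̄_j². Then if Y ~ N(M₁, S₁), the random variable LLR(Y) has the same distribution as Σ_{j ∈ K₁} w̄_j·(Z_j + ν̄_j)² + σ₁·Z' + C₁, where Z' and the Z_j, j ∈ K₁, are independent standard normal random variables. -/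

import Mathlib

open Matrix MeasureTheory ProbabilityTheory

noncomputable section

/-- Density of the multivariate Gaussian `N(M, S)` (for `S` positive definite) with
respect to Lebesgue measure. -/
def gaussDensity {m : ℕ} (M : Fin m → ℝ) (S : Matrix (Fin m) (Fin m) ℝ)
    (y : Fin m → ℝ) : ℝ :=
  (2 * Real.pi) ^ (-(m : ℝ) / 2) * S.det ^ (-(1 : ℝ) / 2) *
    Real.exp (-((y - M) ⬝ᵥ S⁻¹.mulVec (y - M)) / 2)

/-- The nondegenerate multivariate Gaussian measure `N(M, S)` on `ℝ^m`. -/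
def gaussMeasure {m : ℕ} (M : Fin m → ℝ) (S : Matrix (Fin m) (Fin m) ℝ) :
    Measure (Fin m → ℝ) :=
  volume.withDensity fun y => ENNReal.ofReal (gaussDensity M S y)

/-- A finite product of measures with densities has the product of the densities as density. -/
theorem pi_withDensity_ofReal {ι α : Type*} [Fintype ι] [MeasurableSpace α] (μ : Measure α)
    [SigmaFinite μ] {g : α → ℝ} (hg : Integrable g μ) (hg0 : ∀ x, 0 ≤ g x)
    [SigmaFinite (μ.withDensity fun x => ENNReal.ofReal (g x))] :
    (Measure.pi fun _ : ι => μ.withDensity fun x => ENNReal.ofReal (g x)) =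
      (Measure.pi fun _ : ι => μ).withDensity fun x => ENNReal.ofReal (∏ i, g (x i)) := by
  refine Measure.pi_eq fun s hs => ?_
  rw [withDensity_apply _ (MeasurableSet.univ_pi hs), Measure.restrict_pi_pi,
    ← ofReal_integral_eq_lintegral_ofReal
      (Integrable.fintype_prod (f := fun _ => g) fun i => hg.restrict)
      (Filter.Eventually.of_forall fun x => Finset.prod_nonneg fun i _ => hg0 _),
    integral_fintype_prod_eq_prod (fun _ => g),
    ENNReal.ofReal_prod_of_nonneg fun i _ => integral_nonneg hg0]
  refine Finset.prod_congr rfl fun i _ => ?_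
  rw [withDensity_apply _ (hs i), ofReal_integral_eq_lintegral_ofReal hg.restrict
    (Filter.Eventually.of_forall hg0)]

theorem map_withDensity_comp {α β : Type*} [MeasurableSpace α] [MeasurableSpace β]
    (μ : Measure α) {T : α → β} (hT : Measurable T) {f : β → ENNReal} (hf : Measurable f) :
    (μ.withDensity fun x => f (T x)).map T = (μ.map T).withDensity f := by
  ext s hs
  rw [Measure.map_apply hT hs, withDensity_apply _ (hT hs), withDensity_apply _ hs,
    setLIntegral_map hs hf hT]

theorem measurable_gaussDensity {m : ℕ} (M : Fin m → ℝ) (S : Matrix (Fin m) (Fin m) ℝ) :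
    Measurable (gaussDensity M S) := by
  unfold gaussDensity
  refine Measurable.const_mul (Continuous.measurable ?_) _
  fun_prop

theorem mulVec_dotProduct_eq_dotProduct_transpose_mulVec {m n R : Type*} [Fintype m] [Fintype n]
    [CommSemiring R] (A : Matrix m n R) (v : n → R) (w : m → R) :
    A *ᵥ v ⬝ᵥ w = v ⬝ᵥ Aᵀ *ᵥ w := by
  rw [← vecMul_transpose, dotProduct_mulVec]

theorem dotProduct_inv_mul_transpose_mulVec {m : ℕ} {A : Matrix (Fin m) (Fin m) ℝ}
    (hA : A.det ≠ 0) (z : Fin m → ℝ) :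
    A *ᵥ z ⬝ᵥ (A * Aᵀ)⁻¹ *ᵥ (A *ᵥ z) = z ⬝ᵥ z := by
  have hu : IsUnit A.det := hA.isUnit
  have hut : IsUnit Aᵀ.det := by rwa [det_transpose]
  have h : Aᵀ * ((A * Aᵀ)⁻¹ * A) = 1 := by
    rw [Matrix.mul_inv_rev, Matrix.mul_assoc, Matrix.nonsing_inv_mul _ hu, Matrix.mul_one,
      Matrix.mul_nonsing_inv _ hut]
  rw [mulVec_dotProduct_eq_dotProduct_transpose_mulVec, mulVec_mulVec, mulVec_mulVec,
    Matrix.mul_assoc, h, one_mulVec]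

/-- The density of `N(M, A Aᵀ)` along `z ↦ M + A z` is the standard normal density, up to the
Jacobian of this map. -/
theorem prod_gaussianPDFReal_eq {m : ℕ} (M : Fin m → ℝ) {A : Matrix (Fin m) (Fin m) ℝ}
    (hA : A.det ≠ 0) (z : Fin m → ℝ) :
    ∏ i, gaussianPDFReal 0 1 (z i) = |A.det| * gaussDensity M (A * Aᵀ) (M + A *ᵥ z) := by
  have hdet : (A * Aᵀ).det ^ (-(1 : ℝ) / 2) = |A.det|⁻¹ := by
    rw [det_mul, det_transpose, ← abs_mul_abs_self, ← pow_two, ← Real.rpow_natCast,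
      ← Real.rpow_mul (abs_nonneg _), ← Real.rpow_neg_one]
    norm_num
  have hpi : (2 * Real.pi) ^ (-(m : ℝ) / 2) = (√(2 * Real.pi))⁻¹ ^ m := by
    rw [Real.sqrt_eq_rpow, ← Real.rpow_neg (by positivity), ← Real.rpow_natCast,
      ← Real.rpow_mul (by positivity)]
    congr 1
    ring
  have hA' : |A.det| ≠ 0 := abs_ne_zero.mpr hA
  simp only [gaussDensity, add_sub_cancel_left, dotProduct_inv_mul_transpose_mulVec hA, hdet, hpi,
    gaussianPDFReal, Finset.prod_mul_distrib, ← Real.exp_sum]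
  simp only [dotProduct, sub_zero, NNReal.coe_one, mul_one, Finset.prod_const, Finset.card_univ,
    Fintype.card_fin, ← Finset.sum_div, ← Finset.sum_neg_distrib, pow_two]
  field_simp

theorem gaussMeasure_eq_map {m : ℕ} (M : Fin m → ℝ) {A : Matrix (Fin m) (Fin m) ℝ}
    (hA : A.det ≠ 0) :
    gaussMeasure M (A * Aᵀ) =
      (Measure.pi fun _ : Fin m => gaussianReal 0 1).map fun z => M + A *ᵥ z := by
  have hT : Measurable fun z : Fin m → ℝ => M + A *ᵥ z :=
    Continuous.measurable (by fun_prop)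
  have hf : Measurable fun y => ENNReal.ofReal |A.det| *
      ENNReal.ofReal (gaussDensity M (A * Aᵀ) y) :=
    ((measurable_gaussDensity _ _).ennreal_ofReal).const_mul _
  have hvol : (volume : Measure (Fin m → ℝ)).map (fun z => M + A *ᵥ z) =
      ENNReal.ofReal |A.det⁻¹| • volume := by
    have : (fun z : Fin m → ℝ => M + A *ᵥ z) = (fun y => M + y) ∘ toLin' A := by
      ext z; simp
    rw [this, ← Measure.map_map (by fun_prop)
        (LinearMap.continuous_of_finiteDimensional _).measurable,
      Real.map_matrix_volume_pi_eq_smul_volume_pi hA, Measure.map_smul, map_add_left_eq_self]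
  have hstd : (Measure.pi fun _ : Fin m => gaussianReal 0 1) =
      volume.withDensity fun z => ENNReal.ofReal |A.det| *
        ENNReal.ofReal (gaussDensity M (A * Aᵀ) (M + A *ᵥ z)) := by
    have h1 : gaussianReal 0 1 =
        volume.withDensity fun x => ENNReal.ofReal (gaussianPDFReal 0 1 x) :=
      gaussianReal_of_var_ne_zero 0 one_ne_zero
    have : IsProbabilityMeasure
        (volume.withDensity fun x => ENNReal.ofReal (gaussianPDFReal 0 1 x)) := by
      rw [← h1]; infer_instance
    rw [h1, pi_withDensity_ofReal _ (integrable_gaussianPDFReal 0 1)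
      (gaussianPDFReal_nonneg 0 1), ← volume_pi]
    simp_rw [prod_gaussianPDFReal_eq M hA, ENNReal.ofReal_mul (abs_nonneg A.det)]
  rw [hstd, map_withDensity_comp _ hT hf, hvol, withDensity_smul_measure, gaussMeasure,
    ← withDensity_smul _ hf]
  congr 1
  ext y
  rw [Pi.smul_apply, smul_eq_mul, ← mul_assoc, ← ENNReal.ofReal_mul (abs_nonneg _), ← abs_mul,
    inv_mul_cancel₀ hA, abs_one, ENNReal.ofReal_one, one_mul]

theorem log_gaussDensity {m : ℕ} (M : Fin m → ℝ) {S : Matrix (Fin m) (Fin m) ℝ}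
    (hS : 0 < S.det) (y : Fin m → ℝ) :
    Real.log (gaussDensity M S y) = -(m : ℝ) / 2 * Real.log (2 * Real.pi)
      - Real.log S.det / 2 - (y - M) ⬝ᵥ S⁻¹ *ᵥ (y - M) / 2 := by
  unfold gaussDensity
  rw [Real.log_mul (by positivity) (by positivity), Real.log_mul (by positivity) (by positivity),
    Real.log_exp, Real.log_rpow (by positivity), Real.log_rpow hS]
  ring

/-- In coordinates diagonalizing `AᵀS₀⁻¹A`, the log-likelihood ratio of `N(M₁, A Aᵀ)` against
`N(M₀, S₀)` is a sum of functions of one coordinate each. -/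
theorem log_gaussDensity_sub_log_gaussDensity {m : ℕ} (M0 M1 : Fin m → ℝ)
    {S0 A : Matrix (Fin m) (Fin m) ℝ} (hS0 : S0.PosDef) (hA : A.det ≠ 0) {lam : Fin m → ℝ}
    (hdiag : Aᵀ * S0⁻¹ * A = diagonal lam) (z : Fin m → ℝ) :
    Real.log (gaussDensity M1 (A * Aᵀ) (M1 + A *ᵥ z)) -
        Real.log (gaussDensity M0 S0 (M1 + A *ᵥ z)) =
      (∑ j, ((lam j - 1) / 2 * z j ^ 2 + ((Aᵀ * S0⁻¹) *ᵥ (M1 - M0)) j * z j)) +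
        (Real.log (S0.det / (A * Aᵀ).det) + (M1 - M0) ⬝ᵥ S0⁻¹ *ᵥ (M1 - M0)) / 2 := by
  have hdet : 0 < (A * Aᵀ).det := by
    rw [det_mul, det_transpose]; exact mul_self_pos.mpr hA
  have hsymm : (S0⁻¹)ᵀ = S0⁻¹ :=
    (conjTranspose_eq_transpose_of_trivial _).symm.trans hS0.inv.isHermitian
  have hy : M1 + A *ᵥ z - M0 = A *ᵥ z + (M1 - M0) := by abel
  have hquad : A *ᵥ z ⬝ᵥ S0⁻¹ *ᵥ (A *ᵥ z) = ∑ j, lam j * z j ^ 2 := by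
    rw [mulVec_dotProduct_eq_dotProduct_transpose_mulVec, mulVec_mulVec, mulVec_mulVec,
      hdiag]
    simp only [dotProduct, mulVec_diagonal]
    exact Finset.sum_congr rfl fun j _ => by ring
  have hcross : A *ᵥ z ⬝ᵥ S0⁻¹ *ᵥ (M1 - M0) =
      ∑ j, ((Aᵀ * S0⁻¹) *ᵥ (M1 - M0)) j * z j := by
    rw [mulVec_dotProduct_eq_dotProduct_transpose_mulVec, mulVec_mulVec, dotProduct_comm]
    rfl
  have hcross' : (M1 - M0) ⬝ᵥ S0⁻¹ *ᵥ (A *ᵥ z) = A *ᵥ z ⬝ᵥ S0⁻¹ *ᵥ (M1 - M0) := by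
    rw [dotProduct_mulVec, ← mulVec_transpose, hsymm, dotProduct_comm]
  have hzz : z ⬝ᵥ z = ∑ j, z j ^ 2 := by simp only [dotProduct, pow_two]
  have hsum : ∑ j, ((lam j - 1) / 2 * z j ^ 2 + ((Aᵀ * S0⁻¹) *ᵥ (M1 - M0)) j * z j) =
      (∑ j, lam j * z j ^ 2 - ∑ j, z j ^ 2) / 2 +
        ∑ j, ((Aᵀ * S0⁻¹) *ᵥ (M1 - M0)) j * z j := by
    rw [Finset.sum_add_distrib, ← Finset.sum_sub_distrib, Finset.sum_div]
    congr 1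
    exact Finset.sum_congr rfl fun j _ => by ring
  rw [log_gaussDensity _ hdet, log_gaussDensity _ hS0.det_pos, add_sub_cancel_left, hy,
    dotProduct_inv_mul_transpose_mulVec hA, mulVec_add, add_dotProduct, dotProduct_add,
    dotProduct_add, hcross', hquad, hcross, hzz, hsum,
    Real.log_div hS0.det_pos.ne' hdet.ne']
  ring

/-- The linear terms with coordinates outside `K` merge into a single normal variable. -/
theorem map_sum_add_const_eq {ι : Type*} [Fintype ι] [DecidableEq ι] (K : Finset ι)
    {g : ι → ℝ → ℝ} (hg : ∀ j, Measurable (g j)) {b : ι → ℝ} (hgb : ∀ j ∉ K, ∀ x, g j x = b j * x)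
    {σ : ℝ} (hσ : σ ^ 2 = ∑ j ∈ Kᶜ, b j ^ 2) (c : ℝ) :
    (Measure.pi fun _ : ι => gaussianReal 0 1).map (fun z => (∑ j, g j (z j)) + c) =
      ((Measure.pi fun _ : ι => gaussianReal 0 1).prod (gaussianReal 0 1)).map
        fun z => (∑ j ∈ K, g j (z.1 j)) + σ * z.2 + c := by
  have hlin (a t : ℝ) : ∫ x, Complex.exp (t * (a * x : ℝ) * Complex.I) ∂gaussianReal 0 1 =
      Complex.exp (-(t ^ 2 * a ^ 2 / 2)) := by
    have h := charFun_gaussianReal (μ := 0) (v := 1) (t * a)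
    rw [charFun_apply_real] at h
    convert h using 2
    · ext x; push_cast; ring_nf
    · push_cast; ring_nf
  have hL : Measurable fun z : ι → ℝ => ∑ j, g j (z j) := by fun_prop
  have hR : Measurable fun z : (ι → ℝ) × ℝ => (∑ j ∈ K, g j (z.1 j)) + σ * z.2 := by fun_prop
  suffices h : (Measure.pi fun _ : ι => gaussianReal 0 1).map (fun z => ∑ j, g j (z j)) =
      ((Measure.pi fun _ : ι => gaussianReal 0 1).prod (gaussianReal 0 1)).map
        fun z => (∑ j ∈ K, g j (z.1 j)) + σ * z.2 by
    have := congrArg (Measure.map (· + c)) h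
    rwa [Measure.map_map (by fun_prop) hL, Measure.map_map (by fun_prop) hR] at this
  have := Measure.isProbabilityMeasure_map (μ := Measure.pi fun _ : ι => gaussianReal 0 1)
    hL.aemeasurable
  have := Measure.isProbabilityMeasure_map
    (μ := (Measure.pi fun _ : ι => gaussianReal 0 1).prod (gaussianReal 0 1)) hR.aemeasurable
  refine Measure.ext_of_charFun (funext fun t => ?_)
  rw [charFun_apply_real, charFun_apply_real,
    integral_map hL.aemeasurable (by fun_prop),
    integral_map hR.aemeasurable (by fun_prop)]
  have hLe (z : ι → ℝ) : Complex.exp (t * (∑ j, g j (z j) : ℝ) * Complex.I) =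
      ∏ j, Complex.exp (t * (g j (z j) : ℝ) * Complex.I) := by
    rw [← Complex.exp_sum]
    push_cast
    rw [Finset.mul_sum, Finset.sum_mul]
  have hRe (z : (ι → ℝ) × ℝ) :
      Complex.exp (t * ((∑ j ∈ K, g j (z.1 j)) + σ * z.2 : ℝ) * Complex.I) =
      (∏ j, if j ∈ K then Complex.exp (t * (g j (z.1 j) : ℝ) * Complex.I) else 1) *
        Complex.exp (t * (σ * z.2 : ℝ) * Complex.I) := by
    rw [Finset.prod_ite_mem, Finset.univ_inter, ← Complex.exp_sum, ← Complex.exp_add]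
    push_cast
    rw [mul_add, add_mul, Finset.mul_sum, Finset.sum_mul]
  simp_rw [hLe, hRe]
  rw [integral_prod_mul (fun z : ι → ℝ => ∏ j, if j ∈ K then
      Complex.exp (t * (g j (z j) : ℝ) * Complex.I) else 1)
      (fun x : ℝ => Complex.exp (t * (σ * x : ℝ) * Complex.I)),
    integral_fintype_prod_eq_prod (fun j x => Complex.exp (t * (g j x : ℝ) * Complex.I)),
    integral_fintype_prod_eq_prod
      (fun j x => if j ∈ K then Complex.exp (t * (g j x : ℝ) * Complex.I) else 1), hlin,
    ← Finset.prod_mul_prod_compl K, ← Finset.prod_mul_prod_compl K, mul_assoc]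
  congr 1
  · exact Finset.prod_congr rfl fun j hj => by simp only [hj, if_true]
  have hone : ∏ j ∈ Kᶜ, ∫ x, (if j ∈ K then Complex.exp (t * (g j x : ℝ) * Complex.I) else 1)
      ∂gaussianReal 0 1 = 1 :=
    Finset.prod_eq_one fun j hj => by simp [Finset.mem_compl.mp hj]
  have hb : ∏ j ∈ Kᶜ, ∫ x, Complex.exp (t * (g j x : ℝ) * Complex.I) ∂gaussianReal 0 1 =
      ∏ j ∈ Kᶜ, Complex.exp (-(t ^ 2 * b j ^ 2 / 2)) :=
    Finset.prod_congr rfl fun j hj => by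
      simp_rw [hgb j (Finset.mem_compl.mp hj), hlin]
  have hσ' : (σ : ℂ) ^ 2 = ∑ j ∈ Kᶜ, (b j : ℂ) ^ 2 := by exact_mod_cast hσ
  rw [hone, hb, one_mul, ← Complex.exp_sum, hσ', Finset.mul_sum, Finset.sum_div,
    Finset.sum_neg_distrib]

/-- Under `H₁`, i.e. `Y ~ N(M₁,S₁)`, the log-likelihood ratio
`LLR(Y) = log f₁(Y) − log f₀(Y)` has the same distribution as
`Σ_{j ∈ K₁} w̄_j (Z_j + ν̄_j)² + σ₁ Z' + C₁` where `Z'` and the `Z_j` are independent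
standard normal random variables, with `D = M₁−M₀`,
`Φ₁ = S₁^{1/2}S₀⁻¹S₁^{1/2} = Ψ₁ Λ̄ Ψ₁ᵀ`, `w̄_j = (λ̄_j−1)/2`, `b₁ = Ψ₁ᵀS₁^{1/2}S₀⁻¹D`,
`K₁ = {j : w̄_j ≠ 0}`, `ν̄_j = b₁ⱼ/(2w̄_j)`, `σ₁² = Σ_{j∉K₁} b₁ⱼ²`, and
`C₁ = (log(det S₀/det S₁) + DᵀS₀⁻¹D)/2 − Σ_{j∈K₁} w̄_j ν̄_j²`. -/
theorem stmt5 {m : ℕ} (M0 M1 : Fin m → ℝ)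
    (S0 S1 sqrtS1 : Matrix (Fin m) (Fin m) ℝ)
    (hS0 : S0.PosDef) (hS1 : S1.PosDef)
    (hsqrt : sqrtS1.PosDef) (hsqrt2 : sqrtS1 * sqrtS1 = S1)
    (LLR : (Fin m → ℝ) → ℝ)
    (hLLR : ∀ y, LLR y = Real.log (gaussDensity M1 S1 y) - Real.log (gaussDensity M0 S0 y))
    (D : Fin m → ℝ) (hD : D = M1 - M0)
    (Ψ1 : Matrix (Fin m) (Fin m) ℝ) (lamBar : Fin m → ℝ)
    (hΨorth : Ψ1ᵀ * Ψ1 = 1)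
    (hdecomp : sqrtS1 * S0⁻¹ * sqrtS1 = Ψ1 * Matrix.diagonal lamBar * Ψ1ᵀ)
    (wBar : Fin m → ℝ) (hw : ∀ j, wBar j = (lamBar j - 1) / 2)
    (b1 : Fin m → ℝ) (hb1 : b1 = (Ψ1ᵀ * sqrtS1 * S0⁻¹).mulVec D)
    (K1 : Finset (Fin m)) (hK1 : ∀ j, j ∈ K1 ↔ wBar j ≠ 0)
    (νBar : Fin m → ℝ) (hν : ∀ j ∈ K1, νBar j = b1 j / (2 * wBar j))
    (σ1 : ℝ) (hσ1nn : 0 ≤ σ1) (hσ1 : σ1 ^ 2 = ∑ j ∈ K1ᶜ, (b1 j) ^ 2)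
    (C1 : ℝ)
    (hC1 : C1 = (Real.log (S0.det / S1.det) + D ⬝ᵥ S0⁻¹.mulVec D) / 2
        - ∑ j ∈ K1, wBar j * (νBar j) ^ 2) :
    Measure.map LLR (gaussMeasure M1 S1) =
      Measure.map
        (fun z : (Fin m → ℝ) × ℝ =>
          (∑ j ∈ K1, wBar j * (z.1 j + νBar j) ^ 2) + σ1 * z.2 + C1)
        ((Measure.pi fun _ : Fin m => gaussianReal 0 1).prod (gaussianReal 0 1)) := by
  have hdetΨ : Ψ1.det ≠ 0 := fun h => by
    simpa [h] using congrArg Matrix.det hΨorth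
  have hsymm : sqrtS1ᵀ = sqrtS1 :=
    (conjTranspose_eq_transpose_of_trivial _).symm.trans hsqrt.isHermitian
  have hΨorth' : Ψ1 * Ψ1ᵀ = 1 := mul_eq_one_comm.mp hΨorth
  obtain ⟨A, hA⟩ : ∃ A, A = sqrtS1 * Ψ1 := ⟨_, rfl⟩
  have hAt : Aᵀ = Ψ1ᵀ * sqrtS1 := by rw [hA, transpose_mul, hsymm]
  have hdetA : A.det ≠ 0 := by
    rw [hA, det_mul]; exact mul_ne_zero hsqrt.det_pos.ne' hdetΨ
  have hAA : S1 = A * Aᵀ := by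
    rw [hAt, hA, Matrix.mul_assoc, ← Matrix.mul_assoc Ψ1, hΨorth', Matrix.one_mul, hsqrt2]
  have hdiag : Aᵀ * S0⁻¹ * A = diagonal lamBar := by
    calc Aᵀ * S0⁻¹ * A = Ψ1ᵀ * (sqrtS1 * S0⁻¹ * sqrtS1) * Ψ1 := by
          rw [hAt, hA]; simp only [Matrix.mul_assoc]
      _ = (Ψ1ᵀ * Ψ1) * diagonal lamBar * (Ψ1ᵀ * Ψ1) := by
          rw [hdecomp]; simp only [Matrix.mul_assoc]
      _ = diagonal lamBar := by rw [hΨorth, Matrix.one_mul, Matrix.mul_one]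
  have hLLRm : Measurable LLR := by
    rw [funext hLLR]
    exact (measurable_gaussDensity M1 S1).log.sub (measurable_gaussDensity M0 S0).log
  have hT : Measurable fun z : Fin m → ℝ => M1 + A *ᵥ z := Continuous.measurable (by fun_prop)
  let g : Fin m → ℝ → ℝ := fun j x =>
    if j ∈ K1 then wBar j * (x + νBar j) ^ 2 else b1 j * x
  have hg (j : Fin m) : Measurable (g j) := by
    by_cases hj : j ∈ K1 <;> simp only [g, hj, if_true, if_false] <;> fun_prop
  have hcomp : (LLR ∘ fun z => M1 + A *ᵥ z) = fun z => (∑ j, g j (z j)) + C1 := by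
    funext z
    have hterm (j : Fin m) : (lamBar j - 1) / 2 * z j ^ 2 + b1 j * z j =
        g j (z j) - if j ∈ K1 then wBar j * νBar j ^ 2 else 0 := by
      rw [← hw]
      by_cases hj : j ∈ K1
      · have hwj := (hK1 j).mp hj
        simp only [g, hj, if_true, hν j hj]
        field_simp
        ring
      · have hwj : wBar j = 0 := by simpa [hj] using hK1 j
        simp [g, hj, hwj]
    rw [Function.comp_apply, hLLR, hAA,
      log_gaussDensity_sub_log_gaussDensity M0 M1 hS0 hdetA hdiag, ← hD, hAt, ← hb1, ← hAt, ← hAA]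
    simp_rw [hterm]
    rw [Finset.sum_sub_distrib, Finset.sum_ite_mem, Finset.univ_inter, hC1]
    ring
  rw [hAA, gaussMeasure_eq_map M1 hdetA, Measure.map_map hLLRm hT, hcomp,
    map_sum_add_const_eq K1 hg (b := b1) (fun j hj x => by simp [g, hj]) hσ1]
  congr 1
  funext z
  congr 2
  exact Finset.sum_congr rfl fun j hj => by simp [g, hj]

end
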